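/- arXiv:math/9907177 — 2 statements merged into one kernel-verified Lean document; each statement's English description precedes it below -/
import Mathlib

section
/- Fix integers m ≥ 1 and ℓ ≥ 1. The operation of deleting the leftmost column gives a bijection from the set {T ∈ SSYT((m^ℓ)) : cw(T) acts legally on Y((m^ℓ)) and the leftmost column of T has entries exactly 1, 2, …, ℓ from top to bottom} onto the set {T' ∈ SSYT(((m−1)^ℓ)) : cw(T') acts legally on Y(((m+1)^ℓ))}. Moreover, for corresponding T and T', the Young diagram obtained by acting with cw(T) on Y((m^ℓ)) equals the Young diagram obtained by acting with cw(T') on Y(((m+1)^ℓ)). -/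
/-- `IsRectSSYT m ℓ e`: `e` is (the entry function of) a semistandard Young
tableau of rectangular shape `(m^ℓ)`.  Rows `i < ℓ` and columns `j < m` are
0-indexed; entries are positive integers, rows weakly increase, columns strictly
increase, and `e` vanishes outside the rectangle (so that the filling inside
the shape determines `e`). -/
def IsRectSSYT (m ℓ : ℕ) (e : ℕ → ℕ → ℕ) : Prop :=
  (∀ i j, i < ℓ → j < m → 1 ≤ e i j) ∧
  (∀ i j j', i < ℓ → j ≤ j' → j' < m → e i j ≤ e i j') ∧
  (∀ i i' j, i < i' → i' < ℓ → j < m → e i j < e i' j) ∧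
  (∀ i j, ℓ ≤ i ∨ m ≤ j → e i j = 0)

/-- The column word of a rectangular tableau: read each column from top to
bottom, starting with the rightmost column and moving left. -/
def colWord (m ℓ : ℕ) (e : ℕ → ℕ → ℕ) : List ℕ :=
  ((List.range m).reverse.flatMap fun j => (List.range ℓ).map fun i => e i j)

/-- The number `k` acts on a Young diagram, given by its (1-indexed) part
function `lam : ℕ → ℕ`, by adding one box to the `k`-th row. -/
def addBox (lam : ℕ → ℕ) (k : ℕ) : ℕ → ℕ :=
  fun a => if a = k then lam k + 1 else lam a

/-- The action of `k` on `lam` is legal iff `k = 1` or `λ_k < λ_{k−1}`. -/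
def LegalBox (lam : ℕ → ℕ) (k : ℕ) : Prop :=
  k = 1 ∨ lam k < lam (k - 1)

/-- The diagram obtained by letting a word act (left to right). -/
def actWord (lam : ℕ → ℕ) : List ℕ → (ℕ → ℕ)
  | [] => lam
  | k :: w => actWord (addBox lam k) w

/-- A word acts legally iff each successive letter acts legally. -/
def LegalWord (lam : ℕ → ℕ) : List ℕ → Prop
  | [] => True
  | k :: w => LegalBox lam k ∧ LegalWord (addBox lam k) w

/-- The rectangular Young diagram `(m^ℓ)` as a 1-indexed part function. -/
def rectDiagram (m ℓ : ℕ) : ℕ → ℕ :=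
  fun a => if 1 ≤ a ∧ a ≤ ℓ then m else 0

/-- Deleting the leftmost column of a rectangular filling with `m` columns,
yielding a filling with `m − 1` columns (vanishing outside `(m−1)^ℓ`). -/
def delLeftCol (m ℓ : ℕ) (e : ℕ → ℕ → ℕ) : ℕ → ℕ → ℕ :=
  fun i j => if i < ℓ ∧ j < m - 1 then e i (j + 1) else 0

theorem actWord_apply (lam : ℕ → ℕ) (w : List ℕ) (a : ℕ) :
    actWord lam w a = lam a + w.count a := by
  induction w generalizing lam with
  | nil => simp [actWord]
  | cons k w ih =>
    rw [actWord, ih, List.count_cons, addBox]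
    by_cases h : a = k
    · subst h; simp; omega
    · simp [h, Ne.symm h]

theorem actWord_append (lam : ℕ → ℕ) (u v : List ℕ) :
    actWord lam (u ++ v) = actWord (actWord lam u) v := by
  funext a
  simp [actWord_apply, add_assoc]

theorem legalWord_append (lam : ℕ → ℕ) (u v : List ℕ) :
    LegalWord lam (u ++ v) ↔ LegalWord lam u ∧ LegalWord (actWord lam u) v := by
  induction u generalizing lam with
  | nil => simp [LegalWord, actWord]
  | cons k u ih => simp [LegalWord, actWord, ih, and_assoc]

/-- Legality of a word is legality of each of its letters after the preceding prefix. -/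
theorem legalWord_iff_forall_split (lam : ℕ → ℕ) (w : List ℕ) :
    LegalWord lam w ↔ ∀ u k v, w = u ++ k :: v → LegalBox (actWord lam u) k := by
  constructor
  · rintro h u k v rfl
    exact ((legalWord_append lam u (k :: v)).1 h).2.1
  · intro h
    induction w generalizing lam with
    | nil => trivial
    | cons k w ih =>
      refine ⟨h [] k w rfl, ih _ fun u k' v hw => ?_⟩
      exact h (k :: u) k' v (by rw [hw, List.cons_append])

/-- A legal word takes a partition to a partition. -/
theorem LegalWord.actWord_succ_le {lam : ℕ → ℕ} {w : List ℕ} (hw : LegalWord lam w)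
    (hlam : ∀ a, 1 ≤ a → lam (a + 1) ≤ lam a) (a : ℕ) (ha : 1 ≤ a) :
    actWord lam w (a + 1) ≤ actWord lam w a := by
  induction w generalizing lam with
  | nil => exact hlam a ha
  | cons k w ih =>
    refine ih hw.2 fun b hb => ?_
    have hk := hw.1
    have hb' := hlam b hb
    unfold LegalBox at hk
    unfold addBox
    by_cases h1 : b + 1 = k
    · subst h1
      simp at hk ⊢
      omega
    · by_cases h2 : b = k
      · subst h2; simp; omega
      · simpa [h1, h2] using hb'

/-- The word `1 2 ⋯ n` acts legally on every partition. -/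
theorem legalWord_map_succ_range {lam : ℕ → ℕ} (hlam : ∀ a, 1 ≤ a → lam (a + 1) ≤ lam a)
    (n : ℕ) : LegalWord lam ((List.range n).map fun i => i + 1) := by
  induction n with
  | zero => trivial
  | succ n ih =>
    rw [List.range_succ, List.map_append, legalWord_append]
    refine ⟨ih, ?_, trivial⟩
    rcases Nat.eq_zero_or_pos n with rfl | hn
    · exact Or.inl rfl
    · right
      have h1 : ((List.range n).map fun i => i + 1).count (n + 1) = 0 := by
        rw [List.count_eq_zero]; simp
      have h2 : 0 < ((List.range n).map fun i => i + 1).count n := by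
        rw [List.count_pos_iff, List.mem_map]
        exact ⟨n - 1, by simp; omega, by omega⟩
      have := hlam n hn
      simp only [actWord_apply, h1, Nat.add_sub_cancel]
      omega

theorem count_map_succ_range (n a : ℕ) :
    ((List.range n).map fun i => i + 1).count a = if 1 ≤ a ∧ a ≤ n then 1 else 0 := by
  rw [List.Nodup.count (List.nodup_range.map (add_left_injective 1))]
  congr 1
  simp only [List.mem_map, List.mem_range, eq_iff_iff]
  exact ⟨by rintro ⟨i, hi, rfl⟩; omega, fun h => ⟨a - 1, by omega, by omega⟩⟩

theorem rectDiagram_succ_le (m ℓ a : ℕ) (ha : 1 ≤ a) :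
    rectDiagram m ℓ (a + 1) ≤ rectDiagram m ℓ a := by
  unfold rectDiagram
  split_ifs <;> omega

/-- Each column of a semistandard tableau contains a given entry at most once. -/
theorem count_colWord_le {m ℓ : ℕ} {e : ℕ → ℕ → ℕ} (he : IsRectSSYT m ℓ e) (a : ℕ) :
    (colWord m ℓ e).count a ≤ m := by
  rw [colWord, List.count_flatMap]
  refine (List.sum_le_card_nsmul _ 1 ?_).trans (by simp)
  simp only [List.mem_map, List.mem_reverse, List.mem_range, Function.comp]
  rintro _ ⟨j, hj, rfl⟩
  refine List.nodup_iff_count_le_one.1 (List.Nodup.map_on ?_ List.nodup_range) a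
  intro x hx y hy hxy
  rw [List.mem_range] at hx hy
  rcases lt_trichotomy x y with h | h | h
  · have := he.2.2.1 x y j h hy hj; omega
  · exact h
  · have := he.2.2.1 y x j h hx hj; omega

theorem colWord_succ {n ℓ : ℕ} {e : ℕ → ℕ → ℕ} (h0 : ∀ i < ℓ, e i 0 = i + 1) :
    colWord (n + 1) ℓ e =
      colWord n ℓ (delLeftCol (n + 1) ℓ e) ++ (List.range ℓ).map fun i => i + 1 := by
  unfold colWord
  rw [List.range_succ_eq_map, List.reverse_cons, List.flatMap_append, ← List.map_reverse,
    List.flatMap_map]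
  congr 1
  · refine List.flatMap_congr fun j hj => List.map_congr_left fun i hi => ?_
    rw [List.mem_reverse, List.mem_range] at hj
    rw [List.mem_range] at hi
    simp [delLeftCol, hi, hj]
  · rw [List.flatMap_singleton]
    exact List.map_congr_left fun i hi => h0 i (List.mem_range.1 hi)

theorem LegalWord.rectDiagram_succ {m ℓ : ℕ} {w : List ℕ} (h : LegalWord (rectDiagram m ℓ) w) :
    LegalWord (rectDiagram (m + 1) ℓ) w := by
  rw [legalWord_iff_forall_split] at h ⊢
  intro u k v hw
  have := h u k v hw
  simp only [LegalBox, actWord_apply, rectDiagram] at this ⊢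
  split_ifs at this ⊢ <;> omega

/-- Enlarging the rectangle only relaxes the condition on the letter `ℓ + 1`, which is void as long
as that letter occurs at most `m` times. -/
theorem LegalWord.rectDiagram_of_succ {m ℓ : ℕ} {w : List ℕ}
    (h : LegalWord (rectDiagram (m + 1) ℓ) w) (hc : w.count (ℓ + 1) ≤ m) :
    LegalWord (rectDiagram m ℓ) w := by
  rw [legalWord_iff_forall_split] at h ⊢
  intro u k v hw
  have := h u k v hw
  by_cases hk : k = ℓ + 1
  · subst hk
    rw [hw, List.count_append, List.count_cons_self] at hc
    simp only [LegalBox, actWord_apply, rectDiagram] at this ⊢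
    split_ifs at this ⊢ <;> omega
  · simp only [LegalBox, actWord_apply, rectDiagram] at this ⊢
    split_ifs at this ⊢ <;> omega

theorem IsRectSSYT.delLeftCol {n ℓ : ℕ} {e : ℕ → ℕ → ℕ} (he : IsRectSSYT (n + 1) ℓ e) :
    IsRectSSYT n ℓ (delLeftCol (n + 1) ℓ e) := by
  obtain ⟨hpos, hrow, hcol, -⟩ := he
  simp only [IsRectSSYT, _root_.delLeftCol, Nat.add_sub_cancel]
  refine ⟨fun i j hi hj => ?_, fun i j j' hi hj hj' => ?_, fun i i' j hi hi' hj => ?_,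
    fun i j hij => if_neg (by omega)⟩
  · rw [if_pos ⟨hi, hj⟩]
    exact hpos _ _ hi (by omega)
  · rw [if_pos ⟨hi, by omega⟩, if_pos ⟨hi, hj'⟩]
    exact hrow _ _ _ hi (by omega) (by omega)
  · rw [if_pos ⟨by omega, hj⟩, if_pos ⟨hi', hj⟩]
    exact hcol _ _ _ hi hi' (by omega)

/-- Entries in row `i` (counted from `0`) of a semistandard tableau are at least `i + 1`. -/
theorem IsRectSSYT.succ_le {m ℓ : ℕ} {e : ℕ → ℕ → ℕ} (he : IsRectSSYT m ℓ e) {i j : ℕ}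
    (hi : i < ℓ) (hj : j < m) : i + 1 ≤ e i j := by
  induction i with
  | zero => exact he.1 0 j hi hj
  | succ i ih =>
    have := ih (by omega)
    have := he.2.2.1 i (i + 1) j (by omega) hi hj
    omega

/-- Prepending the column `1, …, ℓ` to a filling with `ℓ` rows. -/
def addLeftCol (ℓ : ℕ) (e : ℕ → ℕ → ℕ) : ℕ → ℕ → ℕ :=
  fun i j => if i < ℓ then (if j = 0 then i + 1 else e i (j - 1)) else 0

theorem IsRectSSYT.addLeftCol {n ℓ : ℕ} {e : ℕ → ℕ → ℕ} (he : IsRectSSYT n ℓ e) :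
    IsRectSSYT (n + 1) ℓ (addLeftCol ℓ e) := by
  have hle := fun i j hi hj => he.succ_le (i := i) (j := j) hi hj
  obtain ⟨hpos, hrow, hcol, hzero⟩ := he
  simp only [IsRectSSYT, _root_.addLeftCol]
  refine ⟨fun i j hi hj => ?_, fun i j j' hi hj hj' => ?_, fun i i' j hi hi' hj => ?_,
    fun i j hij => ?_⟩
  · rw [if_pos hi]
    split_ifs with h
    · omega
    · exact hpos _ _ hi (by omega)
  · rw [if_pos hi, if_pos hi]
    split_ifs with h h'
    · exact le_rfl
    · exact hle _ _ hi (by omega)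
    · omega
    · exact hrow _ _ _ hi (by omega) (by omega)
  · rw [if_pos (by omega), if_pos hi']
    split_ifs with h
    · omega
    · exact hcol _ _ _ hi hi' (by omega)
  · split_ifs
    · omega
    · exact hzero _ _ (by omega)
    · rfl

theorem delLeftCol_addLeftCol {n ℓ : ℕ} {e : ℕ → ℕ → ℕ} (he : IsRectSSYT n ℓ e) :
    delLeftCol (n + 1) ℓ (addLeftCol ℓ e) = e := by
  funext i j
  simp only [delLeftCol, addLeftCol, Nat.add_sub_cancel]
  by_cases h : i < ℓ ∧ j < n
  · simp [h]
  · rw [if_neg h]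
    exact (he.2.2.2 i j (by omega)).symm

/-- A filling whose left column is `1, …, ℓ` is determined by its remaining columns. -/
theorem addLeftCol_delLeftCol {n ℓ : ℕ} {e : ℕ → ℕ → ℕ} (he : IsRectSSYT (n + 1) ℓ e)
    (h0 : ∀ i < ℓ, e i 0 = i + 1) : addLeftCol ℓ (delLeftCol (n + 1) ℓ e) = e := by
  funext i j
  simp only [delLeftCol, addLeftCol, Nat.add_sub_cancel]
  split_ifs with h1 h2 h3
  · rw [h2, h0 i h1]
  · rw [Nat.sub_add_cancel (by omega)]
  · exact (he.2.2.2 i j (by omega)).symm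
  · exact (he.2.2.2 i j (by omega)).symm

/-- Deleting the leftmost column is a bijection from
`{T ∈ SSYT((m^ℓ)) : cw(T)` acts legally on `Y((m^ℓ))` and the leftmost column
of `T` is exactly `1, …, ℓ}` onto
`{T' ∈ SSYT(((m−1)^ℓ)) : cw(T')` acts legally on `Y(((m+1)^ℓ))}`; moreover for
corresponding `T, T'` the resulting diagrams coincide:
`cw(T)` acting on `Y((m^ℓ))` gives the same diagram as `cw(T')` acting on
`Y(((m+1)^ℓ))`. -/
theorem rect_ssyt_first_case_bijection (m ℓ : ℕ) (hm : 1 ≤ m) (hl : 1 ≤ ℓ) :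
    Set.BijOn (delLeftCol m ℓ)
      {e | IsRectSSYT m ℓ e ∧ LegalWord (rectDiagram m ℓ) (colWord m ℓ e) ∧
        ∀ i < ℓ, e i 0 = i + 1}
      {e' | IsRectSSYT (m - 1) ℓ e' ∧
        LegalWord (rectDiagram (m + 1) ℓ) (colWord (m - 1) ℓ e')} ∧
    ∀ e, (IsRectSSYT m ℓ e ∧ LegalWord (rectDiagram m ℓ) (colWord m ℓ e) ∧
        ∀ i < ℓ, e i 0 = i + 1) →
      actWord (rectDiagram m ℓ) (colWord m ℓ e) =
        actWord (rectDiagram (m + 1) ℓ) (colWord (m - 1) ℓ (delLeftCol m ℓ e)) := by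
  obtain ⟨n, rfl⟩ : ∃ n, m = n + 1 := ⟨m - 1, by omega⟩
  simp only [Nat.add_sub_cancel]
  refine ⟨⟨?_, ?_, ?_⟩, ?_⟩
  · rintro e ⟨he, hw, h0⟩
    rw [colWord_succ h0, legalWord_append] at hw
    exact ⟨he.delLeftCol, hw.1.rectDiagram_succ⟩
  · rintro e ⟨he, -, h0⟩ f ⟨hf, -, h0'⟩ hef
    rw [← addLeftCol_delLeftCol he h0, ← addLeftCol_delLeftCol hf h0', hef]
  · rintro e ⟨he, hw⟩
    have h0 : ∀ i < ℓ, addLeftCol ℓ e i 0 = i + 1 := fun i hi => by simp [addLeftCol, hi]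
    have hw' : LegalWord (rectDiagram (n + 1) ℓ) (colWord n ℓ e) :=
      hw.rectDiagram_of_succ ((count_colWord_le he _).trans n.le_succ)
    refine ⟨addLeftCol ℓ e, ⟨he.addLeftCol, ?_, h0⟩, delLeftCol_addLeftCol he⟩
    rw [colWord_succ h0, delLeftCol_addLeftCol he, legalWord_append]
    exact ⟨hw', legalWord_map_succ_range (hw'.actWord_succ_le (rectDiagram_succ_le _ _)) ℓ⟩
  · rintro e ⟨-, -, h0⟩
    rw [colWord_succ h0]
    funext a
    rw [actWord_append, actWord_apply, actWord_apply, actWord_apply, count_map_succ_range]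
    unfold rectDiagram
    split_ifs <;> omega
end

section
/- Fix integers m ≥ 1 and ℓ ≥ 1, and let T ∈ SSYT((m^ℓ)) be such that cw(T) acts legally on Y((m^ℓ)) and the leftmost column of T is not exactly 1, 2, …, ℓ. Then every column of T contains the entry ℓ+1 exactly once, and the operation of removing the entry ℓ+1 from each column (shifting the entries below it up by one) gives a bijection from the set of all such T onto the set {T' ∈ SSYT((m^{ℓ−1})) : cw(T') acts legally on Y((m^{ℓ+1}))}. Moreover, for corresponding T and T', the Young diagram obtained by acting with cw(T) on Y((m^ℓ)) equals the Young diagram obtained by acting with cw(T') on Y((m^{ℓ+1})). -/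
/-- Removing the entry `ℓ + 1` from each column of a filling of `(m^ℓ)` and
shifting the entries below it up by one: since columns strictly increase, the
entries above the `ℓ + 1` in a column are exactly those `< ℓ + 1`, so the new
entry in row `i` is the old entry in row `i` if it is `< ℓ + 1`, and the old
entry in row `i + 1` otherwise.  The result is a filling with `ℓ − 1` rows
(vanishing outside `(m^{ℓ−1})`). -/
def removeEllPlusOne (m ℓ : ℕ) (e : ℕ → ℕ → ℕ) : ℕ → ℕ → ℕ :=
  fun i j => if i < ℓ - 1 ∧ j < m then
    (if e i j < ℓ + 1 then e i j else e (i + 1) j) else 0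

open Finset in
/-- The number of indices `j ∈ [a, b)` for which the letter `k` occurs in `f j`. -/
def colCount (f : ℕ → List ℕ) (a b k : ℕ) : ℕ :=
  #{j ∈ Ico a b | k ∈ f j}

/-- The `j`-th column of a filling with `r` rows, read from top to bottom. -/
def fillCol (r : ℕ) (e : ℕ → ℕ → ℕ) (j : ℕ) : List ℕ :=
  (List.range r).map fun i => e i j

/-- Inserting the entry `c` into every column of a filling with `r` rows and `m` columns,
below the entries smaller than `c`. -/
def insertEntry (m r c : ℕ) (e : ℕ → ℕ → ℕ) : ℕ → ℕ → ℕ :=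
  fun i j => if i < r + 1 ∧ j < m then
    (if i < r ∧ e i j < c then e i j
      else if i = 0 ∨ e (i - 1) j < c then c else e (i - 1) j) else 0

theorem mem_fillCol {r : ℕ} {e : ℕ → ℕ → ℕ} {j k : ℕ} :
    k ∈ fillCol r e j ↔ ∃ i < r, e i j = k := by
  simp [fillCol]

theorem colWord_eq_flatMap (m r : ℕ) (e : ℕ → ℕ → ℕ) :
    colWord m r e = (List.range m).reverse.flatMap (fillCol r e) := rfl

theorem colCount_succ_right (f : ℕ → List ℕ) {a b : ℕ} (h : a ≤ b) (k : ℕ) :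
    colCount f a (b + 1) k = colCount f a b k + if k ∈ f b then 1 else 0 := by
  unfold colCount
  rw [← Finset.insert_Ico_right_eq_Ico_add_one h, Finset.filter_insert]
  split_ifs <;> simp

theorem colCount_le (f : ℕ → List ℕ) (a b k : ℕ) : colCount f a b k ≤ b - a := by
  simpa [colCount] using Finset.card_filter_le (Finset.Ico a b) (fun j => k ∈ f j)

theorem colCount_eq_sub_iff (f : ℕ → List ℕ) (a b k : ℕ) :
    colCount f a b k = b - a ↔ ∀ j, a ≤ j → j < b → k ∈ f j := by
  rw [← Nat.card_Ico, colCount, Finset.card_filter_eq_iff]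
  simp

theorem colCount_pos_iff (f : ℕ → List ℕ) (a b k : ℕ) :
    0 < colCount f a b k ↔ ∃ j, a ≤ j ∧ j < b ∧ k ∈ f j := by
  simp [colCount, Finset.card_pos, Finset.Nonempty, and_assoc]

theorem colCount_congr {f g : ℕ → List ℕ} {a b k : ℕ}
    (h : ∀ j < b, (k ∈ f j ↔ k ∈ g j)) : colCount f a b k = colCount g a b k := by
  unfold colCount
  congr 1
  refine Finset.filter_congr fun j hj => h j (Finset.mem_Ico.1 hj).2

theorem actWord_of_pairwise_lt (lam : ℕ → ℕ) {w : List ℕ} (hw : w.Pairwise (· < ·)) (a : ℕ) :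
    actWord lam w a = lam a + if a ∈ w then 1 else 0 := by
  induction w generalizing lam with
  | nil => simp [actWord]
  | cons k w ih =>
    rw [List.pairwise_cons] at hw
    rw [actWord, ih _ hw.2]
    have := hw.1 k
    simp only [addBox, List.mem_cons]
    grind

theorem legalWord_of_pairwise_lt (lam : ℕ → ℕ) {w : List ℕ} (hw : w.Pairwise (· < ·))
    (h0 : 0 ∉ w) :
    LegalWord lam w ↔
      ∀ k ∈ w, k = 1 ∨ lam k < lam (k - 1) + if k - 1 ∈ w then 1 else 0 := by
  induction w generalizing lam with
  | nil => simp [LegalWord]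
  | cons k w ih =>
    rw [List.pairwise_cons] at hw
    simp only [List.mem_cons, not_or] at h0
    have hk : k - 1 ∉ w := fun h => by have := hw.1 _ h; omega
    have hk' : k - 1 ≠ k := by omega
    rw [LegalWord, ih _ hw.2 h0.2, List.forall_mem_cons]
    refine and_congr (by simp [LegalBox, hk, hk']) (forall₂_congr fun x hx => ?_)
    have hx' := hw.1 x hx
    have h1 : k ∉ w := fun h => lt_irrefl _ (hw.1 _ h)
    simp only [addBox, List.mem_cons]
    grind

theorem actWord_flatMap (lam : ℕ → ℕ) (f : ℕ → List ℕ) (n : ℕ)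
    (hf : ∀ j < n, (f j).Pairwise (· < ·)) (a : ℕ) :
    actWord lam ((List.range n).reverse.flatMap f) a = lam a + colCount f 0 n a := by
  induction n generalizing lam with
  | zero => simp [actWord, colCount]
  | succ n ih =>
    rw [List.range_succ, List.reverse_append]
    simp only [List.reverse_singleton, List.singleton_append, List.flatMap_cons]
    rw [actWord_append, ih _ fun j hj => hf j (by omega),
      actWord_of_pairwise_lt _ (hf n (by omega)), colCount_succ_right _ (Nat.zero_le n)]
    ring

theorem legalWord_flatMap (lam : ℕ → ℕ) (f : ℕ → List ℕ) (n : ℕ)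
    (hf : ∀ j < n, (f j).Pairwise (· < ·)) (h0 : ∀ j < n, 0 ∉ f j) :
    LegalWord lam ((List.range n).reverse.flatMap f) ↔
      ∀ j < n, ∀ k ∈ f j,
        k = 1 ∨ lam k + colCount f (j + 1) n k < lam (k - 1) + colCount f j n (k - 1) := by
  induction n generalizing lam with
  | zero => simp [LegalWord]
  | succ n ih =>
    rw [List.range_succ, List.reverse_append]
    simp only [List.reverse_singleton, List.singleton_append, List.flatMap_cons]
    rw [legalWord_append, ih _ (fun j hj => hf j (by omega)) (fun j hj => h0 j (by omega)),
      legalWord_of_pairwise_lt _ (hf n (by omega)) (h0 n (by omega)), Nat.forall_lt_succ_right,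
      and_comm]
    refine and_congr (forall₂_congr fun j hj => forall₂_congr fun k _ => ?_)
      (forall₂_congr fun k _ => ?_)
    · rw [actWord_of_pairwise_lt _ (hf n (by omega)), actWord_of_pairwise_lt _ (hf n (by omega)),
        colCount_succ_right _ (by omega), colCount_succ_right _ (by omega)]
      simp only [add_assoc, add_comm (ite _ _ _)]
    · rw [colCount_succ_right _ le_rfl]
      simp [colCount]

theorem mem_fillCol_insertEntry {m j : ℕ} (r c : ℕ) (e : ℕ → ℕ → ℕ) (hj : j < m) :
    c ∈ fillCol (r + 1) (insertEntry m r c e) j := by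
  classical
  have hex : ∃ i, ¬ (i < r ∧ e i j < c) := ⟨r, by omega⟩
  have hs := Nat.find_spec hex
  have hle : Nat.find hex ≤ r := Nat.find_min' hex (by omega)
  refine mem_fillCol.2 ⟨Nat.find hex, by omega, ?_⟩
  rw [insertEntry, if_pos ⟨by omega, hj⟩, if_neg hs, if_pos]
  by_cases h0 : Nat.find hex = 0
  · exact Or.inl h0
  · exact Or.inr (not_not.1 (Nat.find_min hex (m := Nat.find hex - 1) (by omega))).2

namespace IsRectSSYT

variable {m r : ℕ} {e : ℕ → ℕ → ℕ}

theorem pairwise_fillCol (h : IsRectSSYT m r e) {j : ℕ} (hj : j < m) :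
    (fillCol r e j).Pairwise (· < ·) := by
  rw [fillCol, List.pairwise_map]
  refine List.pairwise_lt_range.imp_of_mem fun {a b} _ hb hab => ?_
  exact h.2.2.1 a b j hab (List.mem_range.1 hb) hj

theorem zero_notMem_fillCol (h : IsRectSSYT m r e) {j : ℕ} (hj : j < m) :
    0 ∉ fillCol r e j := by
  rw [mem_fillCol]
  rintro ⟨i, hi, hij⟩
  have := h.1 i j hi hj
  omega

theorem row_lt_entry (h : IsRectSSYT m r e) {i j : ℕ} (hi : i < r) (hj : j < m) :
    i < e i j := by
  induction i with
  | zero => exact h.1 0 j hi hj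
  | succ i ih =>
    have := ih (by omega)
    have := h.2.2.1 i (i + 1) j (by omega) hi hj
    omega

theorem row_lt_of_entry_lt (h : IsRectSSYT m r e) {i i' j : ℕ} (hi : i < r) (hj : j < m)
    (hlt : e i j < e i' j) : i < i' := by
  by_contra! hle
  rcases hle.eq_or_lt with rfl | h'
  · omega
  · have := h.2.2.1 i' i j h' hi hj
    omega

theorem entry_add_le (h : IsRectSSYT m r e) {i d j : ℕ} (hi : i + d < r) (hj : j < m) :
    e i j + d ≤ e (i + d) j := by
  induction d with
  | zero => simp
  | succ d ih =>
    have := ih (by omega)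
    have := h.2.2.1 (i + d) (i + (d + 1)) j (by omega) hi hj
    omega

theorem legalWord_iff (h : IsRectSSYT m r e) (lam : ℕ → ℕ) :
    LegalWord lam (colWord m r e) ↔
      ∀ j < m, ∀ k ∈ fillCol r e j, k = 1 ∨
        lam k + colCount (fillCol r e) (j + 1) m k <
          lam (k - 1) + colCount (fillCol r e) j m (k - 1) :=
  legalWord_flatMap lam _ m (fun _ hj => h.pairwise_fillCol hj)
    fun _ hj => h.zero_notMem_fillCol hj

/-- If the column word acts legally on `(m^r)`, then the entries exceeding `r` in each column
form an interval starting at `r + 1`. -/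
theorem mem_fillCol_of_legal (h : IsRectSSYT m r e)
    (hleg : LegalWord (rectDiagram m r) (colWord m r e)) {j : ℕ} (hj : j < m) {k : ℕ}
    (hk : r < k) (hkj : k ≤ e (r - 1) j) : k ∈ fillCol r e j := by
  rcases Nat.eq_zero_or_pos r with rfl | hr
  · have := h.2.2.2 0 j (Or.inl le_rfl)
    simp only [Nat.zero_sub] at hkj
    omega
  rw [h.legalWord_iff] at hleg
  induction hd : m - j using Nat.strong_induction_on generalizing j k with
  | _ d ihd =>
    induction hkj using Nat.decreasingInduction with
    | self => exact mem_fillCol.2 ⟨r - 1, by omega, rfl⟩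
    | of_succ k hk' ihk =>
      have hmem := ihk (by omega)
      have hall : colCount (fillCol r e) (j + 1) m (k + 1) = m - (j + 1) := by
        rw [colCount_eq_sub_iff]
        intro j' hj1 hj2
        refine ihd (m - j') (by omega) hj2 (by omega) ?_ rfl
        exact hk'.trans_le (h.2.1 _ _ _ (by omega) (by omega) hj2)
      have hlt := hleg j hj _ hmem
      have hle := colCount_le (fillCol r e) j m k
      have e1 : rectDiagram m r (k + 1) = 0 := if_neg (by omega)
      have e2 : rectDiagram m r k = 0 := if_neg (by omega)
      rw [Nat.add_sub_cancel, hall, e1, e2] at hlt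
      exact (colCount_eq_sub_iff _ _ _ _).1 (by omega) j le_rfl hj

/-- If the column word acts legally on `(m^c)`, then every entry at most `c` equals its row
index. -/
theorem entry_eq_of_legal (h : IsRectSSYT m r e) {c : ℕ}
    (hleg : LegalWord (rectDiagram m c) (colWord m r e)) {i j : ℕ} (hi : i < r) (hj : j < m)
    (hc : e i j ≤ c) : e i j = i + 1 := by
  rw [h.legalWord_iff] at hleg
  induction hd : m - j using Nat.strong_induction_on generalizing i j with
  | _ d ihd =>
    induction i using Nat.strong_induction_on with
    | _ i ihi =>
      by_contra hne
      have hlt := h.row_lt_entry hi hj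
      have e1 : rectDiagram m c (e i j) = m := if_pos (by omega)
      have e2 : rectDiagram m c (e i j - 1) = m := if_pos (by omega)
      have hpos := hleg j hj _ (mem_fillCol.2 ⟨i, hi, rfl⟩)
      rw [e1, e2] at hpos
      obtain ⟨j', hjj', hj', hmem⟩ :=
        (colCount_pos_iff (fillCol r e) j m (e i j - 1)).1 (by omega)
      obtain ⟨i', hi', he'⟩ := mem_fillCol.1 hmem
      have hle := h.2.1 i' j j' hi' hjj' hj'
      have hii' : i' < i := h.row_lt_of_entry_lt hi' hj (by omega)
      have : e i' j' = i' + 1 := by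
        rcases hjj'.eq_or_lt with rfl | hjj'
        · exact ihi i' hii' hi' (by omega)
        · exact ihd (m - j') (by omega) hi' hj' (by omega) rfl
      omega

theorem removeEllPlusOne_entry (h : IsRectSSYT m (r + 1) e) {i j p : ℕ} (hi : i < r)
    (hj : j < m) (hp : p < r + 1) (hpj : e p j = r + 2) :
    removeEllPlusOne m (r + 1) e i j = if i < p then e i j else e (i + 1) j := by
  have hiff : e i j < r + 1 + 1 ↔ i < p := by
    refine ⟨fun hlt => h.row_lt_of_entry_lt (by omega) hj (by omega), fun hlt => ?_⟩
    have := h.2.2.1 i p j hlt hp hj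
    omega
  simp [removeEllPlusOne, hi, hj, hiff]

theorem mem_fillCol_removeEllPlusOne (h : IsRectSSYT m (r + 1) e) {j k : ℕ} (hj : j < m)
    (hmem : r + 2 ∈ fillCol (r + 1) e j) :
    k ∈ fillCol r (removeEllPlusOne m (r + 1) e) j ↔
      k ∈ fillCol (r + 1) e j ∧ k ≠ r + 2 := by
  obtain ⟨p, hp, hpj⟩ := mem_fillCol.1 hmem
  simp only [mem_fillCol]
  constructor
  · rintro ⟨i, hi, rfl⟩
    rw [h.removeEllPlusOne_entry hi hj hp hpj]
    split_ifs with hip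
    · have := h.2.2.1 i p j hip hp hj
      exact ⟨⟨i, by omega, rfl⟩, by omega⟩
    · have := h.2.2.1 p (i + 1) j (by omega) (by omega) hj
      exact ⟨⟨i + 1, by omega, rfl⟩, by omega⟩
  · rintro ⟨⟨i, hi, rfl⟩, hne⟩
    have hip : i ≠ p := fun hip => hne (hip ▸ hpj)
    rcases lt_or_gt_of_ne hip with hip | hip
    · refine ⟨i, by omega, ?_⟩
      rw [h.removeEllPlusOne_entry (by omega) hj hp hpj, if_pos hip]
    · refine ⟨i - 1, by omega, ?_⟩
      rw [h.removeEllPlusOne_entry (by omega) hj hp hpj, if_neg (by omega),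
        Nat.sub_add_cancel (by omega)]

theorem isRectSSYT_removeEllPlusOne (h : IsRectSSYT m (r + 1) e) :
    IsRectSSYT m r (removeEllPlusOne m (r + 1) e) := by
  obtain ⟨h1, h2, h3, -⟩ := h
  simp only [IsRectSSYT, removeEllPlusOne, Nat.add_sub_cancel]
  refine ⟨fun i j hi hj => ?_, fun i j j' hi hjj' hj' => ?_, fun i i' j hii' hi' hj => ?_,
    fun i j hij => if_neg (by omega)⟩
  · have := h1 i j (by omega) hj
    have := h1 (i + 1) j (by omega) hj
    grind
  · have := h2 i j j' (by omega) hjj' hj'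
    have := h2 (i + 1) j j' (by omega) hjj' hj'
    have := h3 i (i + 1) j' (by omega) (by omega) hj'
    grind
  · have := h3 i i' j (by omega) (by omega) hj
    have := h3 i' (i' + 1) j (by omega) (by omega) hj
    have := h3 (i + 1) (i' + 1) j (by omega) (by omega) hj
    grind

theorem colCount_removeEllPlusOne (h : IsRectSSYT m (r + 1) e)
    (hmem : ∀ j < m, r + 2 ∈ fillCol (r + 1) e j) (a : ℕ) {k : ℕ} (hk : k ≠ r + 2) :
    colCount (fillCol r (removeEllPlusOne m (r + 1) e)) a m k =
      colCount (fillCol (r + 1) e) a m k :=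
  colCount_congr fun j hj => by
    simp [h.mem_fillCol_removeEllPlusOne hj (hmem j hj), hk]

theorem colCount_removeEllPlusOne_self (h : IsRectSSYT m (r + 1) e)
    (hmem : ∀ j < m, r + 2 ∈ fillCol (r + 1) e j) (a : ℕ) :
    colCount (fillCol r (removeEllPlusOne m (r + 1) e)) a m (r + 2) = 0 := by
  by_contra hne
  obtain ⟨j, -, hj, hk⟩ := (colCount_pos_iff _ _ _ _).1 (Nat.pos_of_ne_zero hne)
  exact ((h.mem_fillCol_removeEllPlusOne hj (hmem j hj)).1 hk).2 rfl

theorem legalWord_removeEllPlusOne_iff (h : IsRectSSYT m (r + 1) e)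
    (hmem : ∀ j < m, r + 2 ∈ fillCol (r + 1) e j) :
    LegalWord (rectDiagram m (r + 2)) (colWord m r (removeEllPlusOne m (r + 1) e)) ↔
      LegalWord (rectDiagram m (r + 1)) (colWord m (r + 1) e) := by
  rw [h.isRectSSYT_removeEllPlusOne.legalWord_iff, h.legalWord_iff]
  refine forall₂_congr fun j hj => ?_
  have hfull (a : ℕ) : colCount (fillCol (r + 1) e) a m (r + 2) = m - a :=
    (colCount_eq_sub_iff _ _ _ _).2 fun j _ hj => hmem j hj
  have hbase (k : ℕ) (hk : k ≠ r + 2) : rectDiagram m (r + 2) k = rectDiagram m (r + 1) k := by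
    grind [rectDiagram]
  have hr1 : rectDiagram m (r + 1) (r + 1) = m := if_pos (by omega)
  have hr2 : rectDiagram m (r + 1) (r + 2) = 0 := if_neg (by omega)
  have hr3 : rectDiagram m (r + 1) (r + 3) = 0 := if_neg (by omega)
  have hr4 : rectDiagram m (r + 2) (r + 2) = m := if_pos (by omega)
  have key (k : ℕ) (hk : k ≠ r + 2) :
      rectDiagram m (r + 2) k +
            colCount (fillCol r (removeEllPlusOne m (r + 1) e)) (j + 1) m k <
          rectDiagram m (r + 2) (k - 1) +
            colCount (fillCol r (removeEllPlusOne m (r + 1) e)) j m (k - 1) ↔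
        rectDiagram m (r + 1) k + colCount (fillCol (r + 1) e) (j + 1) m k <
          rectDiagram m (r + 1) (k - 1) + colCount (fillCol (r + 1) e) j m (k - 1) := by
    rw [hbase k hk, h.colCount_removeEllPlusOne hmem _ hk]
    by_cases hk3 : k = r + 3
    · subst hk3
      have := colCount_le (fillCol (r + 1) e) (j + 1) m (r + 3)
      rw [show r + 3 - 1 = r + 2 from rfl, h.colCount_removeEllPlusOne_self hmem, hfull, hr2,
        hr3, hr4]
      omega
    · rw [hbase (k - 1) (by omega), h.colCount_removeEllPlusOne hmem _ (by omega)]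
  constructor
  · intro H k hk
    by_cases hk2 : k = r + 2
    · subst hk2
      right
      rw [show r + 2 - 1 = r + 1 from rfl, hfull, hr1, hr2]
      omega
    · rw [← key k hk2]
      exact H k ((h.mem_fillCol_removeEllPlusOne hj (hmem j hj)).2 ⟨hk, hk2⟩)
  · intro H k hk
    obtain ⟨hk, hk2⟩ := (h.mem_fillCol_removeEllPlusOne hj (hmem j hj)).1 hk
    rw [key k hk2]
    exact H k hk

theorem actWord_removeEllPlusOne (h : IsRectSSYT m (r + 1) e)
    (hmem : ∀ j < m, r + 2 ∈ fillCol (r + 1) e j) :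
    actWord (rectDiagram m (r + 2)) (colWord m r (removeEllPlusOne m (r + 1) e)) =
      actWord (rectDiagram m (r + 1)) (colWord m (r + 1) e) := by
  funext k
  rw [colWord_eq_flatMap, colWord_eq_flatMap,
    actWord_flatMap _ _ _ fun _ hj => h.isRectSSYT_removeEllPlusOne.pairwise_fillCol hj,
    actWord_flatMap _ _ _ fun _ hj => h.pairwise_fillCol hj]
  by_cases hk : k = r + 2
  · subst hk
    rw [h.colCount_removeEllPlusOne_self hmem,
      (colCount_eq_sub_iff (fillCol (r + 1) e) 0 m _).2 fun j _ hj => hmem j hj]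
    simp [rectDiagram]
  · rw [h.colCount_removeEllPlusOne hmem _ hk]
    grind [rectDiagram]

theorem mem_fillCol_of_legal_of_ne (h : IsRectSSYT m (r + 1) e)
    (hleg : LegalWord (rectDiagram m (r + 1)) (colWord m (r + 1) e))
    (hne : ¬ ∀ i < r + 1, e i 0 = i + 1) {j : ℕ} (hj : j < m) :
    r + 2 ∈ fillCol (r + 1) e j := by
  refine h.mem_fillCol_of_legal hleg hj (by omega) ?_
  by_contra! hlt
  refine hne fun i hi => ?_
  have h1 := h.row_lt_entry hi (by omega : 0 < m)
  have h2 := h.2.1 i 0 j hi (by omega) hj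
  have h3 := h.entry_add_le (i := i) (d := r - i) (by omega) hj
  rw [Nat.add_sub_cancel' (by omega)] at h3
  simp only [Nat.add_sub_cancel] at hlt
  omega

theorem isRectSSYT_insertEntry (h : IsRectSSYT m r e) {c : ℕ} (hc : 0 < c)
    (hce : ∀ j < m, c ∉ fillCol r e j) : IsRectSSYT m (r + 1) (insertEntry m r c e) := by
  have hce' (i j : ℕ) (hi : i < r) (hj : j < m) : e i j ≠ c := fun heq =>
    hce j hj (mem_fillCol.2 ⟨i, hi, heq⟩)
  obtain ⟨h1, h2, h3, -⟩ := h
  refine ⟨fun i j hi hj => ?_, fun i j j' hi hjj' hj' => ?_, fun i i' j hii' hi' hj => ?_,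
    fun i j hij => if_neg (by omega)⟩
  · have := h1 i j
    have := h1 (i - 1) j
    grind [insertEntry]
  · have := h2 i j j'
    have := h2 (i - 1) j j'
    grind [insertEntry]
  · have := h3 i i' j hii'
    have := h3 i (i' - 1) j
    have := h3 (i - 1) (i' - 1) j
    have := hce' i j
    have := hce' (i' - 1) j
    grind [insertEntry]

theorem removeEllPlusOne_insertEntry (h : IsRectSSYT m r e)
    (hce : ∀ j < m, r + 2 ∉ fillCol r e j) :
    removeEllPlusOne m (r + 1) (insertEntry m r (r + 2) e) = e := by
  funext i j
  have h4 := h.2.2.2 i j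
  have h3 := h.2.2.1 (i - 1) i j
  have h5 : i < r → j < m → e i j ≠ r + 2 := fun hi hj heq =>
    hce j hj (mem_fillCol.2 ⟨i, hi, heq⟩)
  have h6 := h.2.2.1 i (i + 1) j
  grind [insertEntry, removeEllPlusOne]

theorem insertEntry_removeEllPlusOne (h : IsRectSSYT m (r + 1) e)
    (hmem : ∀ j < m, r + 2 ∈ fillCol (r + 1) e j) :
    insertEntry m r (r + 2) (removeEllPlusOne m (r + 1) e) = e := by
  funext i j
  by_cases hij : i < r + 1 ∧ j < m
  · obtain ⟨hi, hj⟩ := hij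
    obtain ⟨p, hp, hpj⟩ := mem_fillCol.1 (hmem j hj)
    have hr (i : ℕ) (hi : i < r) := h.removeEllPlusOne_entry hi hj hp hpj
    have h1 := hr i
    have h2 := hr (i - 1)
    have h3 := h.2.2.1 i p j
    have h4 := h.2.2.1 p i j
    have h5 := h.2.2.1 p (i + 1) j
    have h6 := h.2.2.1 (i - 1) p j
    simp only [insertEntry, hi, hj, and_self, if_true]
    grind
  · rw [h.2.2.2 i j (by omega)]
    exact if_neg hij

end IsRectSSYT

/-- Let `T ∈ SSYT((m^ℓ))` be such that `cw(T)` acts legally on `Y((m^ℓ))` and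
the leftmost column of `T` is not exactly `1, …, ℓ`.  Then every column of `T`
contains the entry `ℓ + 1` exactly once, and removing the `ℓ + 1` from every
column is a bijection from the set of all such `T` onto
`{T' ∈ SSYT((m^{ℓ−1})) : cw(T')` acts legally on `Y((m^{ℓ+1}))}`; moreover for
corresponding `T, T'` the resulting diagrams coincide. -/
theorem rect_ssyt_second_case_bijection (m ℓ : ℕ) (hm : 1 ≤ m) (hl : 1 ≤ ℓ) :
    (∀ e, IsRectSSYT m ℓ e → LegalWord (rectDiagram m ℓ) (colWord m ℓ e) →
      (¬ ∀ i < ℓ, e i 0 = i + 1) →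
      ∀ j < m, ∃! i, i < ℓ ∧ e i j = ℓ + 1) ∧
    Set.BijOn (removeEllPlusOne m ℓ)
      {e | IsRectSSYT m ℓ e ∧ LegalWord (rectDiagram m ℓ) (colWord m ℓ e) ∧
        ¬ ∀ i < ℓ, e i 0 = i + 1}
      {e' | IsRectSSYT m (ℓ - 1) e' ∧
        LegalWord (rectDiagram m (ℓ + 1)) (colWord m (ℓ - 1) e')} ∧
    ∀ e, (IsRectSSYT m ℓ e ∧ LegalWord (rectDiagram m ℓ) (colWord m ℓ e) ∧
        ¬ ∀ i < ℓ, e i 0 = i + 1) →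
      actWord (rectDiagram m ℓ) (colWord m ℓ e) =
        actWord (rectDiagram m (ℓ + 1))
          (colWord m (ℓ - 1) (removeEllPlusOne m ℓ e)) := by
  obtain ⟨r, rfl⟩ : ∃ r, ℓ = r + 1 := ⟨ℓ - 1, by omega⟩
  rw [Nat.add_sub_cancel]
  refine ⟨fun e he hleg hne j hj => ?_, ?_, fun e ⟨he, hleg, hne⟩ =>
    (he.actWord_removeEllPlusOne fun j hj => he.mem_fillCol_of_legal_of_ne hleg hne hj).symm⟩
  · obtain ⟨i, hi, hij⟩ := mem_fillCol.1 (he.mem_fillCol_of_legal_of_ne hleg hne hj)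
    refine ⟨i, ⟨hi, hij⟩, fun i' ⟨hi', hij'⟩ => ?_⟩
    by_contra hii'
    rcases lt_or_gt_of_ne hii' with hlt | hlt
    · have := he.2.2.1 i' i j hlt hi hj
      omega
    · have := he.2.2.1 i i' j hlt hi' hj
      omega
  · have hnot (e : ℕ → ℕ → ℕ) (he : IsRectSSYT m r e)
        (hleg : LegalWord (rectDiagram m (r + 2)) (colWord m r e)) (j : ℕ) (hj : j < m) :
        r + 2 ∉ fillCol r e j := by
      intro hmem
      obtain ⟨i, hi, hij⟩ := mem_fillCol.1 hmem
      have := he.entry_eq_of_legal hleg hi hj hij.le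
      omega
    refine Set.InvOn.bijOn (f' := insertEntry m r (r + 2)) ⟨?_, ?_⟩ ?_ ?_
    · rintro e ⟨he, hleg, hne⟩
      exact he.insertEntry_removeEllPlusOne fun j hj =>
        he.mem_fillCol_of_legal_of_ne hleg hne hj
    · rintro e ⟨he, hleg⟩
      exact he.removeEllPlusOne_insertEntry (hnot e he hleg)
    · rintro e ⟨he, hleg, hne⟩
      exact ⟨he.isRectSSYT_removeEllPlusOne, (he.legalWord_removeEllPlusOne_iff fun j hj =>
        he.mem_fillCol_of_legal_of_ne hleg hne hj).2 hleg⟩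
    · rintro e ⟨he, hleg⟩
      have hins := he.isRectSSYT_insertEntry (by omega) (hnot e he hleg)
      have hmem (j : ℕ) (hj : j < m) := mem_fillCol_insertEntry r (r + 2) e hj
      refine ⟨hins, ?_, fun hall => ?_⟩
      · rw [← hins.legalWord_removeEllPlusOne_iff hmem,
          he.removeEllPlusOne_insertEntry (hnot e he hleg)]
        exact hleg
      · obtain ⟨i, hi, hi0⟩ := mem_fillCol.1 (hmem 0 (by omega))
        have := hall i hi
        omega
end
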